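/- Suppose q > 1 does not belong to V. Then U_q = V_q; in particular, U_q is a closed subset of ℝ and equals its own closure. -/

import Mathlib

open Classical

noncomputable section

/-- The largest digit in base `q`: `α₁ = ⌈q⌉ - 1`. -/
def alphaOne (q : ℝ) : ℕ := (⌈q⌉ - 1).toNat

/-- `c` (0-indexed: `c i` is the digit `c_{i+1}` of the paper) is an expansion of `x`
in base `q`: all digits lie in `{0, …, α₁}` and `x = ∑_{i≥1} c_i q^{-i}`. -/
def IsExpansionOf (q x : ℝ) (c : ℕ → ℕ) : Prop :=
  (∀ i, c i ≤ alphaOne q) ∧ x = ∑' i, (c i : ℝ) / q ^ (i + 1)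

/-- A sequence is called infinite if it has infinitely many nonzero terms. -/
def InfiniteSeq (c : ℕ → ℕ) : Prop := {i | c i ≠ 0}.Infinite

/-- Strict lexicographic order on sequences. -/
def LexLt (a b : ℕ → ℕ) : Prop := ∃ n, (∀ i, i < n → a i = b i) ∧ a n < b n

/-- Lexicographic order `≤` on sequences. -/
def LexLe (a b : ℕ → ℕ) : Prop := LexLt a b ∨ a = b

/-- `b` is the greedy (lexicographically largest) expansion of `x` in base `q`. -/
def IsGreedyOf (q x : ℝ) (b : ℕ → ℕ) : Prop :=
  IsExpansionOf q x b ∧ ∀ c, IsExpansionOf q x c → LexLe c b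

/-- `a` is the quasi-greedy (lexicographically largest infinite) expansion of `x`
in base `q`. -/
def IsQuasiGreedyOf (q x : ℝ) (a : ℕ → ℕ) : Prop :=
  IsExpansionOf q x a ∧ InfiniteSeq a ∧
    ∀ c, IsExpansionOf q x c → InfiniteSeq c → LexLe c a

/-- The quasi-greedy expansion of `x` in base `q`; by convention it is the zero
sequence whenever no infinite expansion exists (in particular for `x = 0`). -/
def quasiGreedy (q x : ℝ) : ℕ → ℕ :=
  if h : ∃ a, IsQuasiGreedyOf q x a then h.choose else fun _ => 0

/-- The greedy expansion of `x` in base `q` (zero sequence if `x` has no expansion). -/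
def greedy (q x : ℝ) : ℕ → ℕ :=
  if h : ∃ b, IsGreedyOf q x b then h.choose else fun _ => 0

/-- The interval `J_q = [0, α₁/(q-1)]`. -/
def Jq (q : ℝ) : Set ℝ := Set.Icc 0 ((alphaOne q : ℝ) / (q - 1))

/-- `U_q`: the set of real numbers having exactly one expansion in base `q`. -/
def Uq (q : ℝ) : Set ℝ := {x | ∃! c, IsExpansionOf q x c}

/-- `U_q'`: the set of univoque sequences in base `q`. -/
def UqSeq (q : ℝ) : Set (ℕ → ℕ) := {c | ∃ x ∈ Uq q, IsExpansionOf q x c}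

/-- `U`: the set of univoque numbers. -/
def USet : Set ℝ := {q | 1 < q ∧ ∃! c, IsExpansionOf q 1 c}

/-- `V_q`: the set of `x ∈ J_q` such that for every `n ≥ 1` with `a_n(x) > 0` the
conjugated shifted quasi-greedy expansion is lexicographically at most `(α_i)`. -/
def Vq (q : ℝ) : Set ℝ :=
  {x | x ∈ Jq q ∧ ∀ n, 0 < quasiGreedy q x n →
    LexLe (fun i => alphaOne q - quasiGreedy q x (n + 1 + i)) (quasiGreedy q 1)}

/-- `V`: the set of `q > 1` whose quasi-greedy expansion `(α_i)` of `1` satisfies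
`(α₁ - α_{k+i})_{i≥1} ≤ (α_i)_{i≥1}` lexicographically for all `k ≥ 1`. -/
def VSet : Set ℝ :=
  {q | 1 < q ∧ ∀ k, LexLe (fun i => alphaOne q - quasiGreedy q 1 (k + 1 + i)) (quasiGreedy q 1)}

/-- The value `∑ c_i q^{-i}` of a digit sequence in base `q`. -/
def digitValue (q : ℝ) (c : ℕ → ℕ) : ℝ := ∑' i, (c i : ℝ) / q ^ (i + 1)

/-- The part of a sequence strictly after position `n`. -/
def seqTail (n : ℕ) (c : ℕ → ℕ) : ℕ → ℕ := fun i => c (n + 1 + i)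

/-- The conjugate of a sequence with respect to the largest digit `K`. -/
def seqConj (K : ℕ) (c : ℕ → ℕ) : ℕ → ℕ := fun i => K - c i

/-- Every tail of `c` that follows a digit smaller than `K` is lexicographically at most `a`. -/
def TailsLexLe (K : ℕ) (a c : ℕ → ℕ) : Prop := ∀ n, c n < K → LexLe (seqTail n c) a

section Lex

theorem lexLt_trichotomy (a b : ℕ → ℕ) : LexLt a b ∨ a = b ∨ LexLt b a := by
  by_cases h : a = b
  · exact Or.inr (Or.inl h)
  · have hex : ∃ n, a n ≠ b n := Function.ne_iff.mp h
    have hlt : ∀ i, i < Nat.find hex → a i = b i := fun i hi => not_not.mp (Nat.find_min hex hi)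
    rcases lt_or_gt_of_ne (Nat.find_spec hex) with h' | h'
    · exact Or.inl ⟨_, hlt, h'⟩
    · exact Or.inr (Or.inr ⟨_, fun i hi => (hlt i hi).symm, h'⟩)

theorem LexLt.not_lexLe {a b : ℕ → ℕ} (h : LexLt a b) : ¬ LexLe b a := by
  obtain ⟨n, hn, hn'⟩ := h
  rintro (⟨m, hm, hm'⟩ | rfl)
  · rcases lt_trichotomy n m with h | rfl | h
    · have := hm n h
      omega
    · omega
    · have := hn m h
      omega
  · exact lt_irrefl _ hn'

theorem lexLe_of_not_lexLt {a b : ℕ → ℕ} (h : ¬ LexLt b a) : LexLe a b := by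
  rcases lexLt_trichotomy a b with h' | h' | h'
  · exact Or.inl h'
  · exact Or.inr h'
  · exact absurd h' h

theorem LexLe.antisymm {a b : ℕ → ℕ} (h : LexLe a b) (h' : LexLe b a) : a = b :=
  h.resolve_left fun hlt => hlt.not_lexLe h'

theorem LexLt.trans {a b c : ℕ → ℕ} (h : LexLt a b) (h' : LexLt b c) : LexLt a c := by
  obtain ⟨n, hn, hn'⟩ := h
  obtain ⟨m, hm, hm'⟩ := h'
  rcases lt_trichotomy n m with hnm | rfl | hnm
  · exact ⟨n, fun i hi => (hn i hi).trans (hm i (hi.trans hnm)), hm n hnm ▸ hn'⟩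
  · exact ⟨n, fun i hi => (hn i hi).trans (hm i hi), hn'.trans hm'⟩
  · exact ⟨m, fun i hi => (hn i (hi.trans hnm)).trans (hm i hi), (hn m hnm).symm ▸ hm'⟩

theorem LexLe.trans {a b c : ℕ → ℕ} (h : LexLe a b) (h' : LexLe b c) : LexLe a c := by
  rcases h with h | rfl
  · rcases h' with h' | rfl
    · exact Or.inl (h.trans h')
    · exact Or.inl h
  · exact h'

theorem LexLe.seqTail_zero {a b : ℕ → ℕ} (h : LexLe a b) (hab : b 0 ≤ a 0) :
    LexLe (seqTail 0 a) (seqTail 0 b) := by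
  rcases h with ⟨n, hn, hn'⟩ | rfl
  · obtain _ | n := n
    · omega
    · refine Or.inl ⟨n, fun i hi => ?_, ?_⟩
      · simpa [seqTail, add_comm] using hn (i + 1) (by omega)
      · simpa [seqTail, add_comm] using hn'
  · exact Or.inr rfl

theorem isClosed_setOf_lexLe (a : ℕ → ℕ) : IsClosed {c : ℕ → ℕ | LexLe c a} := by
  have h : {c : ℕ → ℕ | LexLe c a}ᶜ = ⋃ n, ((⋂ i ∈ Finset.range n, {c : ℕ → ℕ | a i = c i}) ∩
      {c : ℕ → ℕ | a n < c n}) := by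
    ext c
    have : ¬ LexLe c a ↔ LexLt a c :=
      ⟨fun h => not_not.mp fun h' => h (lexLe_of_not_lexLt h'), LexLt.not_lexLe⟩
    simp [this, LexLt]
  rw [← isOpen_compl_iff, h]
  refine isOpen_iUnion fun n => IsOpen.inter ?_ ?_
  · exact isOpen_biInter_finset fun i _ =>
      (isOpen_discrete {m : ℕ | a i = m}).preimage (continuous_apply i)
  · exact (isOpen_discrete {m : ℕ | a n < m}).preimage (continuous_apply n)

theorem continuous_seqTail (n : ℕ) : Continuous (seqTail n) :=
  continuous_pi fun i => continuous_apply (n + 1 + i)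

theorem continuous_seqConj (K : ℕ) : Continuous (seqConj K) :=
  continuous_pi fun i => (continuous_of_discreteTopology (f := fun m : ℕ => K - m)).comp
    (continuous_apply i)

theorem isClosed_setOf_tailsLexLe (K : ℕ) (a : ℕ → ℕ) :
    IsClosed {c : ℕ → ℕ | TailsLexLe K a c} := by
  have h : {c : ℕ → ℕ | TailsLexLe K a c} =
      ⋂ n, ({c : ℕ → ℕ | ¬ c n < K} ∪ seqTail n ⁻¹' {c | LexLe c a}) := by
    ext c
    simp [TailsLexLe, imp_iff_not_or]
  rw [h]
  refine isClosed_iInter fun n => IsClosed.union ?_ ?_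
  · exact IsClosed.preimage (f := fun c : ℕ → ℕ => c n) (continuous_apply n)
      (isClosed_discrete {m : ℕ | ¬ m < K})
  · exact (isClosed_setOf_lexLe a).preimage (continuous_seqTail n)

theorem TailsLexLe.seqTail {K : ℕ} {a c : ℕ → ℕ} (h : TailsLexLe K a c) (n : ℕ) :
    TailsLexLe K a (seqTail n c) := by
  intro m hm
  have := h (n + 1 + m) hm
  convert this using 1
  funext i
  simp only [_root_.seqTail]
  congr 1
  omega

theorem seqConj_seqConj {K : ℕ} {c : ℕ → ℕ} (hc : ∀ i, c i ≤ K) : seqConj K (seqConj K c) = c := by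
  funext i
  have := hc i
  simp only [seqConj]
  omega

theorem seqTail_le {K : ℕ} {c : ℕ → ℕ} (hc : ∀ i, c i ≤ K) (n i : ℕ) : seqTail n c i ≤ K :=
  hc _

theorem seqConj_le (K : ℕ) (c : ℕ → ℕ) (i : ℕ) : seqConj K c i ≤ K := Nat.sub_le _ _

end Lex

section Value

variable {q : ℝ} {K : ℕ} {c e : ℕ → ℕ}

theorem hasSum_const_div_pow (hq : 1 < q) (k : ℝ) :
    HasSum (fun i : ℕ => k / q ^ (i + 1)) (k / (q - 1)) := by
  have h0 : (0 : ℝ) < q := by linarith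
  have h1 : q - 1 ≠ 0 := by linarith
  have h := (hasSum_geometric_of_lt_one (inv_nonneg.mpr h0.le) (inv_lt_one_of_one_lt₀ hq)).mul_left
    (k / q)
  have hterm : (fun i : ℕ => k / q ^ (i + 1)) = fun i => k / q * q⁻¹ ^ i := by
    funext i
    rw [inv_pow, pow_succ]
    field_simp
  have hsum : k / (q - 1) = k / q * (1 - q⁻¹)⁻¹ := by
    rw [show 1 - q⁻¹ = (q - 1) / q by field_simp]
    field_simp
  rw [hterm, hsum]
  exact h

theorem summable_digits (hq : 1 < q) (hc : ∀ i, c i ≤ K) :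
    Summable fun i => (c i : ℝ) / q ^ (i + 1) := by
  have h0 : (0 : ℝ) < q := by linarith
  refine Summable.of_nonneg_of_le (fun i => by positivity) (fun i => ?_)
    (hasSum_const_div_pow hq K).summable
  have := hc i
  gcongr

theorem digitValue_nonneg (hq : 1 < q) (c : ℕ → ℕ) : 0 ≤ digitValue q c := by
  have h0 : (0 : ℝ) < q := by linarith
  exact tsum_nonneg fun i => by positivity

theorem digitValue_pos (hq : 1 < q) (hc : ∀ i, c i ≤ K) (h : ∃ i, c i ≠ 0) :
    0 < digitValue q c := by
  have h0 : (0 : ℝ) < q := by linarith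
  obtain ⟨i, hi⟩ := h
  have := Nat.pos_of_ne_zero hi
  exact (summable_digits hq hc).tsum_pos (fun i => by positivity) i (by positivity)

theorem InfiniteSeq.seqTail (h : InfiniteSeq c) (n : ℕ) : InfiniteSeq (seqTail n c) := by
  refine Set.infinite_of_not_bddAbove fun ⟨b, hb⟩ => ?_
  obtain ⟨m, hm, hm'⟩ := h.exists_gt (n + 1 + b)
  have : m - (n + 1) ≤ b := hb (by
    simp only [_root_.seqTail, Set.mem_ofPred_eq] at hm ⊢
    rwa [show n + 1 + (m - (n + 1)) = m by omega])
  omega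

theorem InfiniteSeq.exists_ne (h : InfiniteSeq c) : ∃ i, c i ≠ 0 := h.nonempty

theorem digitValue_seqConj (hq : 1 < q) (hc : ∀ i, c i ≤ K) :
    digitValue q (seqConj K c) = K / (q - 1) - digitValue q c := by
  have h := (hasSum_const_div_pow hq (K : ℝ)).sub (summable_digits hq hc).hasSum
  have heq : (fun i => (seqConj K c i : ℝ) / q ^ (i + 1)) =
      fun i => (K : ℝ) / q ^ (i + 1) - (c i : ℝ) / q ^ (i + 1) := by
    funext i
    rw [seqConj, Nat.cast_sub (hc i), sub_div]
  rw [digitValue, heq]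
  exact h.tsum_eq

theorem digitValue_le (hq : 1 < q) (hc : ∀ i, c i ≤ K) : digitValue q c ≤ K / (q - 1) := by
  have := digitValue_seqConj hq hc
  have := digitValue_nonneg hq (seqConj K c)
  linarith

theorem digitValue_eq_sum_add (hq : 1 < q) (hc : ∀ i, c i ≤ K) (n : ℕ) :
    digitValue q c = ∑ i ∈ Finset.range n, (c i : ℝ) / q ^ (i + 1) +
      (c n + digitValue q (seqTail n c)) / q ^ (n + 1) := by
  have h0 : (0 : ℝ) < q := by linarith
  rw [digitValue, ← (summable_digits hq hc).sum_add_tsum_nat_add (n + 1), Finset.sum_range_succ,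
    add_div, add_assoc]
  congr 2
  rw [digitValue, ← tsum_div_const]
  refine tsum_congr fun i => ?_
  rw [seqTail, show i + (n + 1) = n + 1 + i by ring, div_div, ← pow_add]
  congr 2
  ring

theorem digitValue_sub (hq : 1 < q) (hc : ∀ i, c i ≤ K) (he : ∀ i, e i ≤ K) {n : ℕ}
    (h : ∀ i, i < n → c i = e i) :
    digitValue q c - digitValue q e =
      (c n - e n + digitValue q (seqTail n c) - digitValue q (seqTail n e)) / q ^ (n + 1) := by
  rw [digitValue_eq_sum_add hq hc n, digitValue_eq_sum_add hq he n,
    Finset.sum_congr rfl fun i hi => by rw [h i (Finset.mem_range.mp hi)]]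
  ring

theorem digitValue_seqTail_of_eq (hq : 1 < q) (hc : ∀ i, c i ≤ K) (he : ∀ i, e i ≤ K) {n : ℕ}
    (h : ∀ i, i < n → c i = e i) (hv : digitValue q c = digitValue q e) :
    c n + digitValue q (seqTail n c) = e n + digitValue q (seqTail n e) := by
  have h0 : (0 : ℝ) < q := by linarith
  have := digitValue_sub hq hc he h
  rw [hv, sub_self, eq_comm, div_eq_zero_iff] at this
  have := this.resolve_right (by positivity)
  linarith

theorem continuousOn_digitValue (hq : 1 < q) (K : ℕ) :
    ContinuousOn (digitValue q) (Set.univ.pi fun _ => Set.Iic K) := by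
  have h0 : (0 : ℝ) < q := by linarith
  refine continuousOn_tsum (u := fun i : ℕ => (K : ℝ) / q ^ (i + 1)) (fun i => ?_)
    (hasSum_const_div_pow hq K).summable fun i c hc => ?_
  · exact (((continuous_of_discreteTopology (f := fun m : ℕ => (m : ℝ))).comp
      (continuous_apply i)).div_const _).continuousOn
  · have : c i ≤ K := hc i (Set.mem_univ i)
    rw [Real.norm_of_nonneg (by positivity)]
    gcongr

end Value

section QuasiGreedy

variable {q x : ℝ} {c : ℕ → ℕ}

theorem le_alphaOne_add_one (hq : 1 < q) : q ≤ alphaOne q + 1 := by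
  have h1 : 1 < ⌈q⌉ := by exact_mod_cast hq.trans_le (Int.le_ceil q)
  have h2 : ((alphaOne q : ℤ)) = ⌈q⌉ - 1 := Int.toNat_of_nonneg (by omega)
  have h3 : (alphaOne q : ℝ) = ⌈q⌉ - 1 := by exact_mod_cast h2
  linarith [Int.le_ceil q]

theorem alphaOne_pos (hq : 1 < q) : 0 < alphaOne q := by
  have : (0 : ℝ) < alphaOne q := by linarith [le_alphaOne_add_one hq]
  exact_mod_cast this

theorem one_le_alphaOne_div (hq : 1 < q) : 1 ≤ (alphaOne q : ℝ) / (q - 1) := by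
  rw [le_div_iff₀ (by linarith)]
  linarith [le_alphaOne_add_one hq]

/-- An infinite digit sequence all of whose tails following a non-maximal digit have value at
most `1`. -/
structure IsQuasiGreedySeq (q : ℝ) (c : ℕ → ℕ) : Prop where
  le : ∀ i, c i ≤ alphaOne q
  infinite : InfiniteSeq c
  tail_le : ∀ n, c n < alphaOne q → digitValue q (seqTail n c) ≤ 1

theorem exists_isQuasiGreedySeq (hq : 1 < q) (hx : 0 < x) (hx' : x ≤ alphaOne q / (q - 1)) :
    ∃ c, IsQuasiGreedySeq q c ∧ digitValue q c = x := by
  have h0 : (0 : ℝ) < q := by linarith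
  have h1 : 0 < q - 1 := by linarith
  set K := alphaOne q
  let d : ℝ → ℕ := fun r => min K (⌈q * r⌉₊ - 1)
  let r : ℕ → ℝ := fun n => Nat.rec x (fun _ s => q * s - d s) n
  have hstep : ∀ n, r (n + 1) = q * r n - d (r n) := fun n => rfl
  have hnext : ∀ s : ℝ, 0 < s → s ≤ K / (q - 1) →
      0 < q * s - d s ∧ q * s - d s ≤ K / (q - 1) ∧ (d s < K → q * s - d s ≤ 1) := by
    intro s hs hs'
    have hpos : 0 < q * s := by positivity
    have hc : 1 ≤ ⌈q * s⌉₊ := Nat.one_le_iff_ne_zero.mpr (Nat.ceil_pos.mpr hpos).ne'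
    have hlt := Nat.ceil_lt_add_one hpos.le
    have hle := Nat.le_ceil (q * s)
    have hsub : ((⌈q * s⌉₊ - 1 : ℕ) : ℝ) = ⌈q * s⌉₊ - 1 := by push_cast [hc]; ring
    have hd : (d s : ℝ) ≤ ⌈q * s⌉₊ - 1 := by
      rw [← hsub]
      exact_mod_cast min_le_right _ _
    have hsmall : d s < K → q * s - d s ≤ 1 := by
      intro h
      have : d s = ⌈q * s⌉₊ - 1 := by simp only [d] at h ⊢; omega
      rw [this, hsub]
      linarith
    refine ⟨by linarith, ?_, hsmall⟩
    rcases (min_le_left K _ : d s ≤ K).lt_or_eq with h | h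
    · exact (hsmall h).trans (one_le_alphaOne_div hq)
    · have h : d s = K := h
      rw [h]
      rw [le_div_iff₀ h1] at hs' ⊢
      nlinarith
  have hr : ∀ n, 0 < r n ∧ r n ≤ K / (q - 1) := by
    intro n
    induction n with
    | zero => exact ⟨hx, hx'⟩
    | succ n ih => exact ⟨(hnext _ ih.1 ih.2).1, (hnext _ ih.1 ih.2).2.1⟩
  have hle : ∀ n, d (r n) ≤ K := fun n => min_le_left _ _
  have hsum : ∀ m n, ∑ i ∈ Finset.range n, (d (r (m + i)) : ℝ) / q ^ (i + 1) =
      r m - r (m + n) / q ^ n := by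
    intro m n
    induction n with
    | zero => simp
    | succ n ih =>
      rw [Finset.sum_range_succ, ih, ← add_assoc, hstep, pow_succ]
      field_simp
      ring
  have hval : ∀ m, digitValue q (fun i => d (r (m + i))) = r m := by
    intro m
    have hs := (summable_digits (c := fun i => d (r (m + i))) hq
      fun i => hle _).hasSum.tendsto_sum_nat
    refine tendsto_nhds_unique hs ?_
    simp only [hsum]
    have hz : Filter.Tendsto (fun n : ℕ => (K / (q - 1)) / q ^ n) Filter.atTop (nhds 0) :=
      (tendsto_pow_atTop_atTop_of_one_lt hq).const_div_atTop _
    have : Filter.Tendsto (fun n => r (m + n) / q ^ n) Filter.atTop (nhds 0) := by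
      refine squeeze_zero (fun n => ?_) (fun n => ?_) hz
      · have := (hr (m + n)).1
        positivity
      · have := (hr (m + n)).2
        gcongr
    simpa using this.const_sub (r m)
  refine ⟨fun i => d (r i), ⟨hle, ?_, ?_⟩, ?_⟩
  · refine Set.infinite_of_not_bddAbove fun ⟨b, hb⟩ => ?_
    have hzero : ∀ i, d (r (b + 1 + i)) = 0 := by
      intro i
      by_contra h
      have : b + 1 + i ≤ b := hb h
      omega
    have h := hval (b + 1)
    simp only [hzero, digitValue] at h
    have := (hr (b + 1)).1
    simp at h
    linarith
  · intro n hn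
    rw [show seqTail n (fun i => d (r i)) = fun i => d (r (n + 1 + i)) from rfl, hval, hstep]
    exact (hnext _ (hr n).1 (hr n).2).2.2 hn
  · simpa [r] using hval 0

theorem exists_digits (hq : 1 < q) (hx : 0 ≤ x) (hx' : x ≤ alphaOne q / (q - 1)) :
    ∃ c : ℕ → ℕ, (∀ i, c i ≤ alphaOne q) ∧ digitValue q c = x := by
  rcases hx.eq_or_lt with rfl | hx
  · exact ⟨fun _ => 0, fun _ => Nat.zero_le _, by simp [digitValue]⟩
  · obtain ⟨c, hc, hv⟩ := exists_isQuasiGreedySeq hq hx hx'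
    exact ⟨c, hc.le, hv⟩

theorem IsQuasiGreedySeq.lexLe (hq : 1 < q) {a : ℕ → ℕ} (ha : IsQuasiGreedySeq q a)
    (hc : ∀ i, c i ≤ alphaOne q) (hinf : InfiniteSeq c) (hv : digitValue q c = digitValue q a) :
    LexLe c a := by
  refine lexLe_of_not_lexLt fun ⟨n, hn, hn'⟩ => ?_
  have h := digitValue_seqTail_of_eq hq ha.le hc hn hv.symm
  have h1 := ha.tail_le n (hn'.trans_le (hc n))
  have h2 := digitValue_pos hq (seqTail_le hc n) (hinf.seqTail n).exists_ne
  have h3 : (a n : ℝ) + 1 ≤ c n := by exact_mod_cast hn'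
  linarith

theorem IsQuasiGreedySeq.lexLe_of_digitValue_lt (hq : 1 < q) {a : ℕ → ℕ}
    (ha : IsQuasiGreedySeq q a) (hc : ∀ i, c i ≤ alphaOne q)
    (hv : digitValue q c < digitValue q a) : LexLe c a := by
  have h0 : (0 : ℝ) < q := by linarith
  refine lexLe_of_not_lexLt fun ⟨n, hn, hn'⟩ => ?_
  have h := digitValue_sub hq ha.le hc hn
  have h1 := ha.tail_le n (hn'.trans_le (hc n))
  have h2 := digitValue_nonneg hq (seqTail n c)
  have h3 : (a n : ℝ) + 1 ≤ c n := by exact_mod_cast hn'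
  have h4 : (a n - c n + digitValue q (seqTail n a) - digitValue q (seqTail n c)) / q ^ (n + 1)
      ≤ 0 := div_nonpos_of_nonpos_of_nonneg (by linarith) (by positivity)
  linarith

theorem IsQuasiGreedySeq.quasiGreedy_eq (hq : 1 < q) (hc : IsQuasiGreedySeq q c) :
    quasiGreedy q (digitValue q c) = c := by
  have h : IsQuasiGreedyOf q (digitValue q c) c :=
    ⟨⟨hc.le, rfl⟩, hc.infinite, fun e he hinf => hc.lexLe hq he.1 hinf he.2.symm⟩
  have hex : ∃ a, IsQuasiGreedyOf q (digitValue q c) a := ⟨c, h⟩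
  rw [quasiGreedy, dif_pos hex]
  have hs := hex.choose_spec
  exact (h.2.2 _ hs.1 hs.2.1).antisymm (hs.2.2 _ h.1 h.2.1)

theorem isQuasiGreedySeq_quasiGreedy (hq : 1 < q) (hx : 0 < x)
    (hx' : x ≤ alphaOne q / (q - 1)) :
    IsQuasiGreedySeq q (quasiGreedy q x) ∧ digitValue q (quasiGreedy q x) = x := by
  obtain ⟨c, hc, rfl⟩ := exists_isQuasiGreedySeq hq hx hx'
  rw [hc.quasiGreedy_eq hq]
  exact ⟨hc, rfl⟩

theorem quasiGreedy_zero (hq : 1 < q) : quasiGreedy q 0 = fun _ => 0 := by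
  refine dif_neg fun ⟨a, ha, hinf, _⟩ => ?_
  exact (digitValue_pos hq ha.1 hinf.exists_ne).ne ha.2

theorem isExpansionOf_quasiGreedy (hq : 1 < q) (hx : x ∈ Jq q) :
    IsExpansionOf q x (quasiGreedy q x) := by
  rcases hx.1.eq_or_lt with rfl | h
  · rw [quasiGreedy_zero hq]
    exact ⟨fun _ => Nat.zero_le _, by simp⟩
  · have := isQuasiGreedySeq_quasiGreedy hq h hx.2
    exact ⟨this.1.le, this.2.symm⟩

theorem isQuasiGreedySeq_quasiGreedy_one (hq : 1 < q) :
    IsQuasiGreedySeq q (quasiGreedy q 1) ∧ digitValue q (quasiGreedy q 1) = 1 :=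
  isQuasiGreedySeq_quasiGreedy hq one_pos (one_le_alphaOne_div hq)

theorem lexLe_quasiGreedy_one_of_lt (hq : 1 < q) (hc : ∀ i, c i ≤ alphaOne q)
    (hv : digitValue q c < 1) : LexLe c (quasiGreedy q 1) := by
  have h := isQuasiGreedySeq_quasiGreedy_one hq
  exact h.1.lexLe_of_digitValue_lt hq hc (h.2.symm ▸ hv)

theorem lexLe_quasiGreedy_one_of_le (hq : 1 < q) (hc : ∀ i, c i ≤ alphaOne q)
    (hinf : InfiniteSeq c) (hv : digitValue q c ≤ 1) : LexLe c (quasiGreedy q 1) := by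
  have h := isQuasiGreedySeq_quasiGreedy_one hq
  rcases hv.lt_or_eq with hv | hv
  · exact lexLe_quasiGreedy_one_of_lt hq hc hv
  · exact h.1.lexLe hq hc hinf (hv.trans h.2.symm)

theorem quasiGreedy_one_zero (hq : 1 < q) : quasiGreedy q 1 0 = alphaOne q := by
  obtain ⟨h, hv⟩ := isQuasiGreedySeq_quasiGreedy_one hq
  refine le_antisymm (h.le 0) (not_lt.mp fun hlt => ?_)
  have h1 := h.tail_le 0 hlt
  have h2 := digitValue_eq_sum_add hq h.le 0
  rw [hv] at h2
  simp only [Finset.range_zero, Finset.sum_empty, zero_add, pow_one] at h2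
  rw [eq_div_iff (by linarith)] at h2
  have h3 : q ≤ quasiGreedy q 1 0 + 1 := by linarith
  have h4 : alphaOne q ≤ quasiGreedy q 1 0 := by
    have : ⌈q⌉ ≤ (quasiGreedy q 1 0 : ℤ) + 1 := Int.ceil_le.mpr (by exact_mod_cast h3)
    rw [alphaOne]
    omega
  omega

theorem lexLe_seqTail_zero_quasiGreedy_one (hq : 1 < q) :
    LexLe (seqTail 0 (quasiGreedy q 1)) (quasiGreedy q 1) := by
  obtain ⟨h, hv⟩ := isQuasiGreedySeq_quasiGreedy_one hq
  refine lexLe_quasiGreedy_one_of_le hq (seqTail_le h.le 0) (h.infinite.seqTail 0) ?_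
  have h2 := digitValue_eq_sum_add hq h.le 0
  rw [hv, quasiGreedy_one_zero hq] at h2
  simp only [Finset.range_zero, Finset.sum_empty, zero_add, pow_one] at h2
  rw [eq_div_iff (by linarith)] at h2
  linarith [le_alphaOne_add_one hq]

theorem mem_VSet_of_forall_pos (hq : 1 < q)
    (h : ∀ k, 0 < quasiGreedy q 1 k →
      LexLe (seqConj (alphaOne q) (seqTail k (quasiGreedy q 1))) (quasiGreedy q 1)) :
    q ∈ VSet := by
  refine ⟨hq, fun k => ?_⟩
  change LexLe (seqConj (alphaOne q) (seqTail k (quasiGreedy q 1))) (quasiGreedy q 1)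
  induction k with
  | zero => exact h 0 (by rw [quasiGreedy_one_zero hq]; exact alphaOne_pos hq)
  | succ k ih =>
    rcases Nat.eq_zero_or_pos (quasiGreedy q 1 (k + 1)) with h0 | h0
    · have h1 := ih.seqTail_zero (by simp [seqConj, seqTail, h0, quasiGreedy_one_zero hq])
      refine LexLe.trans ?_ (h1.trans (lexLe_seqTail_zero_quasiGreedy_one hq))
      refine Or.inr (funext fun i => ?_)
      simp only [seqConj, seqTail]
      congr 2
      omega
    · exact h _ h0

theorem digitValue_le_one_of_tailsLexLe (hq : 1 < q) (hc : ∀ i, c i ≤ alphaOne q)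
    (h : TailsLexLe (alphaOne q) (quasiGreedy q 1) c) (h' : LexLe c (quasiGreedy q 1)) :
    digitValue q c ≤ 1 := by
  have h0 : (0 : ℝ) < q := by linarith
  obtain ⟨ha, hv⟩ := isQuasiGreedySeq_quasiGreedy_one hq
  set C : ℝ := alphaOne q / (q - 1)
  have hC : 0 ≤ C := zero_le_one.trans (one_le_alphaOne_div hq)
  have key : ∀ N : ℕ, ∀ e : ℕ → ℕ, (∀ i, e i ≤ alphaOne q) →
      TailsLexLe (alphaOne q) (quasiGreedy q 1) e → LexLe e (quasiGreedy q 1) →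
      digitValue q e - 1 ≤ C / q ^ N := by
    intro N
    induction N with
    | zero =>
      intro e he _ _
      have := digitValue_le hq he
      simp only [pow_zero, div_one]
      linarith
    | succ N ih =>
      intro e he het hlex
      rcases hlex with ⟨n, hn, hn'⟩ | rfl
      · have hlt := hn'.trans_le (ha.le n)
        have h1 := ih _ (seqTail_le he n) (het.seqTail n) (het n hlt)
        have h2 := digitValue_sub hq he ha.le hn
        have h3 := digitValue_nonneg hq (seqTail n (quasiGreedy q 1))
        have h4 : (e n : ℝ) + 1 ≤ quasiGreedy q 1 n := by exact_mod_cast hn'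
        rw [hv] at h2
        rw [h2, pow_succ q N, ← div_div]
        have hqn : q ≤ q ^ (n + 1) := le_self_pow₀ hq.le (by omega)
        calc _ ≤ (C / q ^ N) / q ^ (n + 1) := by gcongr; linarith
          _ ≤ _ := by gcongr
      · rw [hv, sub_self]
        positivity
  have hz : Filter.Tendsto (fun n : ℕ => C / q ^ n) Filter.atTop (nhds 0) :=
    (tendsto_pow_atTop_atTop_of_one_lt hq).const_div_atTop _
  have := ge_of_tendsto' hz fun N => key N c hc h h'
  linarith

theorem eq_quasiGreedy_one_of_tailsLexLe (hq : 1 < q) (hc : ∀ i, c i ≤ alphaOne q)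
    (h : TailsLexLe (alphaOne q) (quasiGreedy q 1) c) (h' : LexLe c (quasiGreedy q 1))
    (hv : 1 ≤ digitValue q c) : c = quasiGreedy q 1 := by
  obtain ⟨ha, hv'⟩ := isQuasiGreedySeq_quasiGreedy_one hq
  have heq : digitValue q c = 1 := (digitValue_le_one_of_tailsLexLe hq hc h h').antisymm hv
  refine h'.resolve_left fun ⟨n, hn, hn'⟩ => ?_
  have h1 := digitValue_seqTail_of_eq hq hc ha.le hn (heq.trans hv'.symm)
  have h2 := digitValue_le_one_of_tailsLexLe hq (seqTail_le hc n) (h.seqTail n)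
    (h n (hn'.trans_le (ha.le n)))
  have h3 := digitValue_pos hq (seqTail_le ha.le n) (ha.infinite.seqTail n).exists_ne
  have h4 : (c n : ℝ) + 1 ≤ quasiGreedy q 1 n := by exact_mod_cast hn'
  linarith

end QuasiGreedy

section Univoque

variable {q x : ℝ} {c : ℕ → ℕ}

/-- `c` is the unique expansion of its value in base `q`. -/
def IsUnivoqueSeq (q : ℝ) (c : ℕ → ℕ) : Prop :=
  (∀ i, c i ≤ alphaOne q) ∧
    ∀ e : ℕ → ℕ, (∀ i, e i ≤ alphaOne q) → digitValue q e = digitValue q c → e = c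

theorem IsUnivoqueSeq.seqConj (hq : 1 < q) (h : IsUnivoqueSeq q c) :
    IsUnivoqueSeq q (seqConj (alphaOne q) c) := by
  refine ⟨seqConj_le _ _, fun e he hv => ?_⟩
  rw [← h.2 _ (seqConj_le (alphaOne q) e), seqConj_seqConj he]
  rw [digitValue_seqConj hq he, hv, digitValue_seqConj hq h.1]
  ring

theorem IsUnivoqueSeq.tailsLexLe (hq : 1 < q) (h : IsUnivoqueSeq q c) :
    TailsLexLe (alphaOne q) (quasiGreedy q 1) c := by
  intro n hn
  refine lexLe_quasiGreedy_one_of_lt hq (seqTail_le h.1 n) (not_le.mp fun hge => ?_)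
  obtain ⟨d, hd, hdv⟩ := exists_digits (x := digitValue q (seqTail n c) - 1) hq (by linarith) (by
    have := digitValue_le hq (seqTail_le h.1 n)
    linarith)
  let e : ℕ → ℕ := fun i => if i < n then c i else if i = n then c n + 1 else d (i - (n + 1))
  have he : ∀ i, e i ≤ alphaOne q := by
    intro i
    simp only [e]
    split_ifs
    · exact h.1 i
    · exact hn
    · exact hd _
  have hen : e n = c n + 1 := by simp [e]
  have htail : seqTail n e = d := by
    funext i
    simp only [seqTail, e]
    rw [if_neg (by omega), if_neg (by omega)]
    congr 1
    omega
  have hv := digitValue_sub hq he h.1 (n := n) fun i hi => by simp [e, hi]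
  rw [htail, hdv, hen] at hv
  have : e = c := h.2 e he (by
    rw [← sub_eq_zero, hv]
    push_cast
    rw [div_eq_zero_iff]
    left
    ring)
  rw [this] at hen
  omega

theorem mem_VSet_of_seqTail_eq_quasiGreedy_one (hq : 1 < q)
    (h : TailsLexLe (alphaOne q) (quasiGreedy q 1) (seqConj (alphaOne q) c)) {n : ℕ}
    (hn : seqTail n c = quasiGreedy q 1) : q ∈ VSet := by
  refine mem_VSet_of_forall_pos hq fun k hk => ?_
  have h1 := (h.seqTail n) k (by
    have : c (n + 1 + k) = quasiGreedy q 1 k := congrFun hn k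
    have := alphaOne_pos hq
    simp only [seqTail, seqConj]
    omega)
  rw [← hn]
  rw [← hn] at h1
  exact h1

theorem digitValue_seqTail_lt_one (hq : 1 < q) (hV : q ∉ VSet) (hc : ∀ i, c i ≤ alphaOne q)
    (h : TailsLexLe (alphaOne q) (quasiGreedy q 1) c)
    (h' : TailsLexLe (alphaOne q) (quasiGreedy q 1) (seqConj (alphaOne q) c)) {n : ℕ}
    (hn : c n < alphaOne q) : digitValue q (seqTail n c) < 1 :=
  not_le.mp fun hge => hV (mem_VSet_of_seqTail_eq_quasiGreedy_one hq h'
    (eq_quasiGreedy_one_of_tailsLexLe hq (seqTail_le hc n) (h.seqTail n) (h n hn) hge))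

theorem not_lexLt_of_digitValue_eq (hq : 1 < q) (hV : q ∉ VSet) (hc : ∀ i, c i ≤ alphaOne q)
    (h : TailsLexLe (alphaOne q) (quasiGreedy q 1) c)
    (h' : TailsLexLe (alphaOne q) (quasiGreedy q 1) (seqConj (alphaOne q) c))
    {e : ℕ → ℕ} (he : ∀ i, e i ≤ alphaOne q) (hv : digitValue q e = digitValue q c) :
    ¬ LexLt c e := by
  rintro ⟨n, hn, hn'⟩
  have h1 := digitValue_seqTail_lt_one hq hV hc h h' (hn'.trans_le (he n))
  have h2 := digitValue_seqTail_of_eq hq hc he hn hv.symm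
  have h3 := digitValue_nonneg hq (seqTail n e)
  have h4 : (c n : ℝ) + 1 ≤ e n := by exact_mod_cast hn'
  linarith

theorem isUnivoqueSeq_of_tailsLexLe (hq : 1 < q) (hV : q ∉ VSet) (hc : ∀ i, c i ≤ alphaOne q)
    (h : TailsLexLe (alphaOne q) (quasiGreedy q 1) c)
    (h' : TailsLexLe (alphaOne q) (quasiGreedy q 1) (seqConj (alphaOne q) c)) :
    IsUnivoqueSeq q c := by
  refine ⟨hc, fun e he hv => ?_⟩
  rcases lexLt_trichotomy e c with hlt | heq | hlt
  · have hv' : digitValue q (seqConj (alphaOne q) e) = digitValue q (seqConj (alphaOne q) c) := by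
      rw [digitValue_seqConj hq he, digitValue_seqConj hq hc, hv]
    refine absurd ?_ (not_lexLt_of_digitValue_eq hq hV (seqConj_le _ _) h'
      ((seqConj_seqConj hc).symm ▸ h) (seqConj_le _ _) hv')
    obtain ⟨n, hn, hn'⟩ := hlt
    refine ⟨n, fun i hi => by simp only [seqConj, hn i hi], ?_⟩
    have := hc n
    simp only [seqConj]
    omega
  · exact heq
  · exact absurd hlt (not_lexLt_of_digitValue_eq hq hV hc h h' he hv)

theorem mem_Uq_iff : x ∈ Uq q ↔ ∃ c, IsUnivoqueSeq q c ∧ digitValue q c = x := by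
  constructor
  · rintro ⟨c, ⟨hc, rfl⟩, huniq⟩
    exact ⟨c, ⟨hc, fun e he hv => huniq e ⟨he, hv.symm⟩⟩, rfl⟩
  · rintro ⟨c, hc, rfl⟩
    exact ⟨c, ⟨hc.1, rfl⟩, fun e he => hc.2 e he.1 he.2.symm⟩

theorem tailsLexLe_quasiGreedy (hq : 1 < q) (hx : x ∈ Jq q) :
    TailsLexLe (alphaOne q) (quasiGreedy q 1) (quasiGreedy q x) := by
  rcases hx.1.eq_or_lt with rfl | h
  · rw [quasiGreedy_zero hq]
    intro n _
    exact lexLe_quasiGreedy_one_of_lt hq (fun _ => Nat.zero_le _) (by simp [digitValue, seqTail])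
  · have ha := (isQuasiGreedySeq_quasiGreedy hq h hx.2).1
    exact fun n hn => lexLe_quasiGreedy_one_of_le hq (seqTail_le ha.le n) (ha.infinite.seqTail n)
      (ha.tail_le n hn)

theorem mem_Vq_iff (hq : 1 < q) : x ∈ Vq q ↔ x ∈ Jq q ∧
    TailsLexLe (alphaOne q) (quasiGreedy q 1) (seqConj (alphaOne q) (quasiGreedy q x)) := by
  refine and_congr_right fun hx => forall_congr' fun n => ?_
  have h1 := (isExpansionOf_quasiGreedy hq hx).1 n
  have h2 := alphaOne_pos hq
  refine imp_congr ?_ Iff.rfl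
  simp only [seqConj]
  omega

theorem Uq_subset_Vq (hq : 1 < q) : Uq q ⊆ Vq q := by
  intro x hx
  obtain ⟨c, hc, rfl⟩ := mem_Uq_iff.mp hx
  have hJ : digitValue q c ∈ Jq q := ⟨digitValue_nonneg hq c, digitValue_le hq hc.1⟩
  have ha := isExpansionOf_quasiGreedy hq hJ
  rw [mem_Vq_iff hq, hc.2 _ ha.1 ha.2.symm]
  exact ⟨hJ, (hc.seqConj hq).tailsLexLe hq⟩

theorem Vq_subset_Uq (hq : 1 < q) (hV : q ∉ VSet) : Vq q ⊆ Uq q := by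
  intro x hx
  obtain ⟨hJ, hx⟩ := (mem_Vq_iff hq).mp hx
  have ha := isExpansionOf_quasiGreedy hq hJ
  exact mem_Uq_iff.mpr ⟨_, isUnivoqueSeq_of_tailsLexLe hq hV ha.1 (tailsLexLe_quasiGreedy hq hJ) hx,
    ha.2.symm⟩

theorem Uq_eq_image (hq : 1 < q) (hV : q ∉ VSet) :
    Uq q = digitValue q '' ((Set.univ.pi fun _ => Set.Iic (alphaOne q)) ∩
      ({c | TailsLexLe (alphaOne q) (quasiGreedy q 1) c} ∩
        seqConj (alphaOne q) ⁻¹' {c | TailsLexLe (alphaOne q) (quasiGreedy q 1) c})) := by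
  ext x
  rw [mem_Uq_iff]
  refine exists_congr fun c => and_congr_left fun _ => ⟨fun hc => ?_, fun ⟨hc, h, h'⟩ => ?_⟩
  · exact ⟨fun i _ => hc.1 i, hc.tailsLexLe hq, (hc.seqConj hq).tailsLexLe hq⟩
  · exact isUnivoqueSeq_of_tailsLexLe hq hV (fun i => hc i (Set.mem_univ i)) h h'

theorem isClosed_Uq (hq : 1 < q) (hV : q ∉ VSet) : IsClosed (Uq q) := by
  have hclosed := isClosed_setOf_tailsLexLe (alphaOne q) (quasiGreedy q 1)
  have hcompact : IsCompact (Set.univ.pi fun _ : ℕ => Set.Iic (alphaOne q)) :=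
    isCompact_univ_pi fun _ => (Set.finite_Iic _).isCompact
  rw [Uq_eq_image hq hV]
  refine IsCompact.isClosed (IsCompact.image_of_continuousOn
    (hcompact.inter_right (hclosed.inter (hclosed.preimage (continuous_seqConj _)))) ?_)
  exact ((continuousOn_digitValue hq _).mono Set.inter_subset_left)

end Univoque

/-- If `q > 1` does not belong to `V`, then `U_q = V_q`; in
particular `U_q` is closed and equals its own closure. -/
theorem Uq_eq_Vq_of_not_mem_V (q : ℝ) (hq : 1 < q) (h : q ∉ VSet) :
    Uq q = Vq q ∧ IsClosed (Uq q) ∧ closure (Uq q) = Uq q := by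
  have hclosed := isClosed_Uq hq h
  exact ⟨(Uq_subset_Vq hq).antisymm (Vq_subset_Uq hq h), hclosed, hclosed.closure_eq⟩
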